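/- arXiv:math/9504215 — 2 statements merged into one kernel-verified Lean document; each statement's English description precedes it below -/
import Mathlib

section
/- Let α > -1 be a real number, k ≥ 1 an integer, and a > 0. Then ∫_0^a R_k^α(x) e^{-x} x^α dx = (1/(α+1)) e^{-a} a^{α+1} R_{k-1}^{α+1}(a). Consequently, if α ≥ 0, then for each fixed a > 0 one has ∫_0^a R_k^α(x) e^{-x} x^α dx → 0 as k → ∞. -/
open MeasureTheory Filter Set

noncomputable section

/-- Generalized binomial coefficient `C(a, m) = Γ(a+1)/(Γ(m+1)Γ(a-m+1))`. -/
def genBinom (a : ℝ) (m : ℕ) : ℝ :=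
  Real.Gamma (a + 1) / (Real.Gamma ((m : ℝ) + 1) * Real.Gamma (a - (m : ℝ) + 1))

/-- The Laguerre polynomial `L_k^α(x) = Σ_{j=0}^k (-1)^j C(k+α, k-j) x^j / j!`. -/
def laguerreL (α : ℝ) (k : ℕ) (x : ℝ) : ℝ :=
  ∑ j ∈ Finset.range (k + 1),
    (-1 : ℝ) ^ j * genBinom ((k : ℝ) + α) (k - j) * x ^ j / (Nat.factorial j : ℝ)

/-- The normalized Laguerre polynomial `R_k^α(x) = L_k^α(x)/L_k^α(0)`,
with `L_k^α(0) = C(k+α, k)`. -/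
def laguerreR (α : ℝ) (k : ℕ) (x : ℝ) : ℝ := laguerreL α k x / genBinom ((k : ℝ) + α) k

/-- `f ∈ L_{w(α)}`: `∫_0^∞ |f(x)| e^{-x/2} x^α dx < ∞`. -/
def MemLaguerreL (α : ℝ) (f : ℝ → ℝ) : Prop :=
  IntegrableOn (fun x => f x * Real.exp (-x / 2) * x ^ α) (Ioi 0)

end

/-- The confluent hypergeometric form of the normalized Laguerre polynomial. -/
lemma laguerreR_eq_sum {α : ℝ} (hα : -1 < α) (k : ℕ) (x : ℝ) :
    laguerreR α k x = ∑ j ∈ Finset.range (k + 1),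
      (-1 : ℝ) ^ j * (k.choose j : ℝ) *
        (Real.Gamma (α + 1) / Real.Gamma (α + 1 + j)) * x ^ j := by
  unfold laguerreR laguerreL
  rw [Finset.sum_div]
  refine Finset.sum_congr rfl fun j hj => ?_
  have hjk : j ≤ k := Nat.lt_succ_iff.mp (Finset.mem_range.mp hj)
  have hα1 : 0 < α + 1 := by linarith
  have h1 : Real.Gamma (α + 1) ≠ 0 := (Real.Gamma_pos_of_pos hα1).ne'
  have h2 : Real.Gamma (α + 1 + j) ≠ 0 := (Real.Gamma_pos_of_pos (by positivity)).ne'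
  have h3 : Real.Gamma (k + α + 1) ≠ 0 :=
    (Real.Gamma_pos_of_pos (by rw [add_assoc]; positivity)).ne'
  unfold genBinom
  rw [Real.Gamma_nat_eq_factorial, Real.Gamma_nat_eq_factorial, Nat.cast_sub hjk,
    show (k : ℝ) + α - (k - j) + 1 = α + 1 + j by ring,
    show (k : ℝ) + α - k + 1 = α + 1 by ring, Nat.cast_choose ℝ hjk]
  have h4 : (k.factorial : ℝ) ≠ 0 := by positivity
  have h5 : (j.factorial : ℝ) ≠ 0 := by positivity
  have h6 : ((k - j).factorial : ℝ) ≠ 0 := by positivity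
  field_simp

lemma Gamma_ratio_eq_mul {α : ℝ} (hα : -1 < α) (j : ℕ) :
    Real.Gamma (α + 1) / Real.Gamma (α + 1 + j) =
      (α + 1 + j) * (Real.Gamma (α + 1) / Real.Gamma (α + 1 + (j + 1 : ℕ))) := by
  have hα1 : 0 < α + 1 := by linarith
  have h : 0 < α + 1 + (j : ℝ) := by positivity
  have h2 := (Real.Gamma_pos_of_pos h).ne'
  rw [Nat.cast_succ, ← add_assoc, Real.Gamma_add_one h.ne']
  field_simp

lemma laguerreR_add_one_eq_sum {α : ℝ} (hα : -1 < α) (n : ℕ) (x : ℝ) :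
    laguerreR (α + 1) n x = ∑ j ∈ Finset.range (n + 1),
      (-1 : ℝ) ^ j * (n.choose j : ℝ) *
        ((α + 1) * (Real.Gamma (α + 1) / Real.Gamma (α + 1 + (j + 1 : ℕ)))) * x ^ j := by
  rw [laguerreR_eq_sum (by linarith)]
  refine Finset.sum_congr rfl fun j _ => ?_
  rw [Real.Gamma_add_one (by linarith : α + 1 ≠ 0),
    show α + 1 + 1 + (j : ℝ) = α + 1 + (j + 1 : ℕ) by push_cast; ring]
  ring

/-- `d/dx R_{n+1}^α = -((n+1)/(α+1)) R_n^{α+1}`. -/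
lemma hasDerivAt_laguerreR_succ {α : ℝ} (hα : -1 < α) (n : ℕ) (x : ℝ) :
    HasDerivAt (laguerreR α (n + 1))
      (-((n + 1 : ℝ) / (α + 1)) * laguerreR (α + 1) n x) x := by
  have hα1 : α + 1 ≠ 0 := by linarith
  have hd := HasDerivAt.fun_sum (x := x) (u := Finset.range (n + 1 + 1))
    fun j _ => (hasDerivAt_pow j x).const_mul ((-1 : ℝ) ^ j * ((n + 1).choose j : ℝ) *
        (Real.Gamma (α + 1) / Real.Gamma (α + 1 + j)))
  rw [show laguerreR α (n + 1) = _ from funext (laguerreR_eq_sum hα (n + 1))]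
  refine hd.congr_deriv ?_
  rw [Finset.sum_range_succ', laguerreR_add_one_eq_sum hα, Finset.mul_sum]
  simp only [Nat.cast_zero, zero_mul, mul_zero, add_zero, Nat.add_sub_cancel]
  refine Finset.sum_congr rfl fun j _ => ?_
  have hc : ((n + 1).choose (j + 1) : ℝ) * ((j + 1 : ℕ) : ℝ) = (n + 1) * n.choose j := by
    exact_mod_cast (Nat.add_one_mul_choose_eq n j).symm
  set g := Real.Gamma (α + 1) / Real.Gamma (α + 1 + (j + 1 : ℕ))
  have : (-((n + 1 : ℝ) / (α + 1))) * ((-1) ^ j * (n.choose j : ℝ) * ((α + 1) * g) * x ^ j)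
      = -((-1) ^ j * ((n + 1) * n.choose j) * g * x ^ j) := by
    field_simp
  rw [this, ← hc]
  ring

/-- `x (R_n^{α+1})' = (α+1) R_{n+1}^α + (x-α-1) R_n^{α+1}`. -/
lemma exists_hasDerivAt_laguerreR_add_one {α : ℝ} (hα : -1 < α) (n : ℕ) (x : ℝ) :
    ∃ d, HasDerivAt (laguerreR (α + 1) n) d x ∧
      x * d = (α + 1) * laguerreR α (n + 1) x + (x - α - 1) * laguerreR (α + 1) n x := by
  have hd := HasDerivAt.fun_sum (x := x) (u := Finset.range (n + 1))
    fun j _ => (hasDerivAt_pow j x).const_mul ((-1 : ℝ) ^ j * (n.choose j : ℝ) *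
        ((α + 1) * (Real.Gamma (α + 1) / Real.Gamma (α + 1 + (j + 1 : ℕ)))))
  rw [← show laguerreR (α + 1) n = _ from funext (laguerreR_add_one_eq_sum hα n)] at hd
  refine ⟨_, hd, ?_⟩
  set g : ℕ → ℝ := fun j => Real.Gamma (α + 1) / Real.Gamma (α + 1 + j) with hg
  have hgs (j : ℕ) : g j = (α + 1 + j) * g (j + 1) := Gamma_ratio_eq_mul hα j
  have hg0 : g 0 = 1 := by
    simp [hg, (Real.Gamma_pos_of_pos (show 0 < α + 1 by linarith)).ne']
  have hu : laguerreR α (n + 1) x = ∑ j ∈ Finset.range (n + 1),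
        (-1 : ℝ) ^ j * (n.choose j : ℝ) * g j * x ^ j
      - ∑ j ∈ Finset.range (n + 1), (-1 : ℝ) ^ j * (n.choose j : ℝ) * g (j + 1) * x ^ (j + 1) := by
    have hext : ∑ j ∈ Finset.range (n + 1), (-1 : ℝ) ^ j * (n.choose j : ℝ) * g j * x ^ j
        = ∑ j ∈ Finset.range (n + 1 + 1), (-1 : ℝ) ^ j * (n.choose j : ℝ) * g j * x ^ j := by
      rw [Finset.sum_range_succ _ (n + 1)]
      simp
    rw [laguerreR_eq_sum hα, hext, Finset.sum_range_succ', Finset.sum_range_succ' _ (n + 1),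
      add_sub_right_comm, ← Finset.sum_sub_distrib]
    congr 1
    · refine Finset.sum_congr rfl fun j _ => ?_
      rw [Nat.choose_succ_succ]
      push_cast [hg]
      ring
    · simp [hg]
  rw [hu, laguerreR_add_one_eq_sum hα, Finset.mul_sum, mul_sub, Finset.mul_sum, Finset.mul_sum,
    Finset.mul_sum, ← Finset.sum_sub_distrib, ← Finset.sum_add_distrib]
  refine Finset.sum_congr rfl fun j _ => ?_
  change x * ((-1 : ℝ) ^ j * (n.choose j : ℝ) * ((α + 1) * g (j + 1)) * (j * x ^ (j - 1))) =
    _ + (x - α - 1) * ((-1 : ℝ) ^ j * (n.choose j : ℝ) * ((α + 1) * g (j + 1)) * x ^ j)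
  rw [hgs j]
  rcases j with _ | j
  · simp
    ring
  · rw [Nat.add_sub_cancel]
    push_cast
    ring

lemma continuous_laguerreR {α : ℝ} (hα : -1 < α) (k : ℕ) : Continuous (laguerreR α k) := by
  rw [show laguerreR α k = _ from funext (laguerreR_eq_sum hα k)]
  fun_prop

lemma laguerreR_zero_right {α : ℝ} (hα : -1 < α) (k : ℕ) : laguerreR α k 0 = 1 := by
  rw [laguerreR_eq_sum hα, Finset.sum_range_succ']
  simp [(Real.Gamma_pos_of_pos (show 0 < α + 1 by linarith)).ne']

lemma integral_laguerreR_succ {α : ℝ} (hα : -1 < α) (n : ℕ) {a : ℝ} (ha : 0 < a) :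
    (∫ x in Ioc (0 : ℝ) a, laguerreR α (n + 1) x * Real.exp (-x) * x ^ α)
      = (1 / (α + 1)) * Real.exp (-a) * a ^ (α + 1) * laguerreR (α + 1) n a := by
  have hα1 : 0 < α + 1 := by linarith
  rw [← intervalIntegral.integral_of_le ha.le]
  have hcont : Continuous fun x : ℝ =>
      (1 / (α + 1)) * Real.exp (-x) * x ^ (α + 1) * laguerreR (α + 1) n x := by
    have := Real.continuous_rpow_const hα1.le
    have := continuous_laguerreR (show -1 < α + 1 by linarith) n
    fun_prop
  have hint : IntervalIntegrable
      (fun x => laguerreR α (n + 1) x * Real.exp (-x) * x ^ α) volume 0 a := by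
    have := continuous_laguerreR hα (n + 1)
    exact (intervalIntegral.intervalIntegrable_rpow' hα).continuousOn_mul
      (Continuous.continuousOn (by fun_prop))
  rw [intervalIntegral.integral_eq_sub_of_hasDerivAt_of_le ha.le hcont.continuousOn ?_ hint]
  · simp [Real.zero_rpow hα1.ne']
  intro x hx
  obtain ⟨d, hd, hxd⟩ := exists_hasDerivAt_laguerreR_add_one hα n x
  have he : HasDerivAt (fun x : ℝ => Real.exp (-x)) (Real.exp (-x) * -1) x :=
    (hasDerivAt_neg x).exp
  have hp := Real.hasDerivAt_rpow_const (x := x) (p := α + 1) (Or.inl hx.1.ne')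
  refine (((he.const_mul (1 / (α + 1))).mul hp).mul hd).congr_deriv ?_
  simp only [Pi.mul_apply]
  rw [add_sub_cancel_right, Real.rpow_add_one hx.1.ne']
  field_simp
  linear_combination x ^ α * hxd

/-- Energy estimate for the Laguerre differential equation. -/
lemma sq_laguerreR_add_le_exp {α : ℝ} (hα : 0 ≤ α) (n : ℕ) {a : ℝ} (ha : 0 ≤ a) :
    laguerreR α (n + 1) a ^ 2 +
      (n + 1) / (α + 1) ^ 2 * (a * laguerreR (α + 1) n a ^ 2) ≤ Real.exp (2 * a) := by
  have hα' : -1 < α := by linarith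
  have hα1 : 0 < α + 1 := by linarith
  set E : ℝ → ℝ := fun x => laguerreR α (n + 1) x ^ 2 +
      (n + 1) / (α + 1) ^ 2 * (x * laguerreR (α + 1) n x ^ 2) with hE
  have hderiv (x : ℝ) : HasDerivAt (fun x => Real.exp (-(2 * x)) * E x)
      (-(Real.exp (-(2 * x)) * (2 * laguerreR α (n + 1) x ^ 2 +
        (n + 1) / (α + 1) ^ 2 * (2 * α + 1) * laguerreR (α + 1) n x ^ 2))) x := by
    obtain ⟨d, hd, hxd⟩ := exists_hasDerivAt_laguerreR_add_one hα' n x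
    have hu := hasDerivAt_laguerreR_succ hα' n x
    have he : HasDerivAt (fun x : ℝ => Real.exp (-(2 * x))) (Real.exp (-(2 * x)) * -(2 * 1)) x :=
      ((hasDerivAt_id x).const_mul 2).neg.exp
    refine (he.mul ((hu.pow 2).add
      (((hasDerivAt_id x).mul (hd.pow 2)).const_mul ((n + 1 : ℝ) / (α + 1) ^ 2)))).congr_deriv ?_
    simp only [Pi.mul_apply, Pi.add_apply, Pi.pow_apply, id]
    field_simp
    push_cast
    linear_combination (n + 1) * 2 * laguerreR (α + 1) n x * hxd
  have hanti : Antitone fun x => Real.exp (-(2 * x)) * E x :=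
    antitone_of_hasDerivAt_nonpos hderiv fun x => by
      rw [Pi.zero_apply, neg_nonpos]
      positivity
  have h := hanti ha
  simp only [hE, laguerreR_zero_right hα'] at h
  rw [Real.exp_neg, inv_mul_le_iff₀ (Real.exp_pos _)] at h
  simpa using h

lemma tendsto_laguerreR_add_one {α : ℝ} (hα : 0 ≤ α) {a : ℝ} (ha : 0 < a) :
    Tendsto (fun n : ℕ => laguerreR (α + 1) n a) atTop (nhds 0) := by
  have hα1 : 0 < α + 1 := by linarith
  have hsq : Tendsto (fun n : ℕ => laguerreR (α + 1) n a ^ 2) atTop (nhds 0) := by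
    have hlim : Tendsto (fun n : ℕ => (α + 1) ^ 2 * Real.exp (2 * a) / a * (1 / ((n : ℝ) + 1)))
        atTop (nhds 0) := by
      have h := tendsto_one_div_add_atTop_nhds_zero_nat (𝕜 := ℝ) |>.const_mul
        ((α + 1) ^ 2 * Real.exp (2 * a) / a)
      rwa [mul_zero] at h
    refine squeeze_zero (fun n => sq_nonneg _) (fun n => ?_) hlim
    have h := sq_laguerreR_add_le_exp hα n ha.le
    have h' : ((n : ℝ) + 1) / (α + 1) ^ 2 * (a * laguerreR (α + 1) n a ^ 2) ≤ Real.exp (2 * a) :=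
      (le_add_of_nonneg_left (sq_nonneg _)).trans h
    have hn : (0 : ℝ) < n + 1 := by positivity
    field_simp at h' ⊢
    linarith
  have h := hsq.sqrt
  simp only [Real.sqrt_sq_eq_abs, Real.sqrt_zero] at h
  exact (tendsto_zero_iff_abs_tendsto_zero _).mpr h

/-- For `α > -1`, `k ≥ 1` and `a > 0`,
`∫_0^a R_k^α(x) e^{-x} x^α dx = (1/(α+1)) e^{-a} a^{α+1} R_{k-1}^{α+1}(a)`;
consequently, for `α ≥ 0` and fixed `a > 0` this integral tends to `0` as `k → ∞`. -/
theorem laguerre_partial_integral (α : ℝ) (hα : -1 < α) :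
    (∀ k : ℕ, 1 ≤ k → ∀ a : ℝ, 0 < a →
      (∫ x in Ioc (0 : ℝ) a, laguerreR α k x * Real.exp (-x) * x ^ α)
        = (1 / (α + 1)) * Real.exp (-a) * a ^ (α + 1) * laguerreR (α + 1) (k - 1) a) ∧
    (0 ≤ α → ∀ a : ℝ, 0 < a →
      Tendsto (fun k : ℕ =>
          ∫ x in Ioc (0 : ℝ) a, laguerreR α k x * Real.exp (-x) * x ^ α)
        atTop (nhds 0)) := by
  constructor
  · intro k hk a ha
    obtain ⟨n, rfl⟩ := Nat.exists_eq_add_of_le' hk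
    exact integral_laguerreR_succ hα n ha
  · intro hα0 a ha
    rw [← tendsto_add_atTop_iff_nat 1]
    simp only [integral_laguerreR_succ hα _ ha]
    simpa using (tendsto_laguerreR_add_one hα0 ha).const_mul
      ((1 / (α + 1)) * Real.exp (-a) * a ^ (α + 1))
end

section
/- Let -1 < β < 0 and 0 < θ < π. Then for every k ∈ ℕ₀, R_k^{(-1/2, β)}(cos θ) = (cos(θ/2))^{-β-1/2} cos((k + β/2 + 1/4)θ) + (1/4)(β² - 1/4) sin(θ/2) ∫_0^θ (cos(φ/2))^{-β-3/2} cos((k + β/2 + 1/4)φ) · ₂F₁[β/2 + 5/4, β/2 + 3/4; 2; (cos φ - cos θ)/(1 + cos φ)] dφ. -/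
noncomputable section

/-- The Gauss hypergeometric series `₂F₁[a, b; c; x] = Σ_n (a)_n (b)_n / ((c)_n n!) x^n`. -/
def gauss2F1 (a b c x : ℝ) : ℝ :=
  ∑' n : ℕ, ((ascPochhammer ℝ n).eval a * (ascPochhammer ℝ n).eval b) /
    ((ascPochhammer ℝ n).eval c * (Nat.factorial n : ℝ)) * x ^ n

end

open MeasureTheory Filter Set

noncomputable section

/-- The Jacobi polynomial `P_k^{(α,β)}(x)`. -/
def jacobiP (α β : ℝ) (k : ℕ) (x : ℝ) : ℝ :=
  ∑ s ∈ Finset.range (k + 1),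
    genBinom ((k : ℝ) + α) (k - s) * genBinom ((k : ℝ) + β) s *
      ((x - 1) / 2) ^ s * ((x + 1) / 2) ^ (k - s)

/-- The normalized Jacobi polynomial `R_k^{(α,β)}(x) = P_k^{(α,β)}(x)/P_k^{(α,β)}(1)`. -/
def jacobiR (α β : ℝ) (k : ℕ) (x : ℝ) : ℝ := jacobiP α β k x / jacobiP α β k 1

/-- The Jacobi weight `(sin(θ/2))^{2α+1} (cos(θ/2))^{2β+1}`. -/
def jacobiWeight (α β : ℝ) (θ : ℝ) : ℝ :=
  Real.sin (θ / 2) ^ (2 * α + 1) * Real.cos (θ / 2) ^ (2 * β + 1)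

/-- `f ∈ L_{(α,β)}`: `f` is integrable on `[0,π]` against the Jacobi weight. -/
def MemJacobiL (α β : ℝ) (f : ℝ → ℝ) : Prop :=
  IntegrableOn (fun θ => f θ * jacobiWeight α β θ) (Ioc 0 Real.pi)

/-- The norm `‖f‖_{L_{(α,β)}}`. -/
def jacobiNorm (α β : ℝ) (f : ℝ → ℝ) : ℝ :=
  ∫ θ in Ioc (0 : ℝ) Real.pi, |f θ| * jacobiWeight α β θ

/-- The `k`-th Fourier–Jacobi coefficient `f̂_{(α,β)}(k)`. -/
def fourierJacobi (α β : ℝ) (f : ℝ → ℝ) (k : ℕ) : ℝ :=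
  ∫ θ in Ioc (0 : ℝ) Real.pi, f θ * jacobiR α β k (Real.cos θ) * jacobiWeight α β θ

end

open scoped Topology in
/-- Leibniz rule for `x ↦ ∫ y in a..x, M x y` when `M` and its `x`-derivative are continuous on
an open set containing `{x₀} × [a, x₀]`. -/
lemma hasDerivAt_integral_variable_endpoint {M M' : ℝ → ℝ → ℝ} {Ω : Set (ℝ × ℝ)} {a x₀ : ℝ}
    (hΩ : IsOpen Ω) (hM : ContinuousOn (fun p : ℝ × ℝ => M p.1 p.2) Ω)
    (hM' : ContinuousOn (fun p : ℝ × ℝ => M' p.1 p.2) Ω)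
    (hd : ∀ x y, (x, y) ∈ Ω → HasDerivAt (fun x => M x y) (M' x y) x)
    (ha : a ≤ x₀) (hmem : ∀ y ∈ Icc a x₀, (x₀, y) ∈ Ω) :
    HasDerivAt (fun x => ∫ y in a..x, M x y) (M x₀ x₀ + ∫ y in a..x₀, M' x₀ y) x₀ := by
  obtain ⟨u, v, hu, hv, hxu, hxv, huv⟩ := generalized_tube_lemma
    (isCompact_singleton (x := x₀)) (isCompact_Icc (a := a) (b := x₀)) hΩ
    (by rintro ⟨x, y⟩ ⟨rfl, hy⟩; exact hmem y hy)
  have hx₀u : x₀ ∈ u := hxu rfl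
  have hx₀v : x₀ ∈ v := hxv ⟨ha, le_rfl⟩
  obtain ⟨δ, hδ, hδu⟩ := Metric.nhds_basis_closedBall.mem_iff.1 (hu.mem_nhds hx₀u)
  obtain ⟨η, hη, hηv⟩ := Metric.nhds_basis_closedBall.mem_iff.1 (hv.mem_nhds hx₀v)
  have hcont : ∀ x ∈ u, ∀ s ⊆ v, ContinuousOn (M x) s := fun x hx s hs =>
    hM.comp (f := fun y => (x, y)) (by fun_prop) fun y hy => huv ⟨hx, hs hy⟩
  have hcont' : ∀ x ∈ u, ∀ s ⊆ v, ContinuousOn (M' x) s := fun x hx s hs =>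
    hM'.comp (f := fun y => (x, y)) (by fun_prop) fun y hy => huv ⟨hx, hs hy⟩
  have hseg : uIcc a x₀ ⊆ v := by rwa [uIcc_of_le ha]
  have hseg' : ∀ x ∈ Metric.closedBall x₀ η, uIcc x₀ x ⊆ v := fun x hx =>
    ((convex_closedBall x₀ η).ordConnected.uIcc_subset
      (Metric.mem_closedBall_self hη.le) hx).trans hηv
  have hintM : ∀ x ∈ u, IntervalIntegrable (M x) volume a x₀ := fun x hx =>
    (hcont x hx _ hseg).intervalIntegrable
  have hfix : HasDerivAt (fun x => ∫ y in a..x₀, M x y) (∫ y in a..x₀, M' x₀ y) x₀ := by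
    obtain ⟨B, hB⟩ := ((isCompact_closedBall x₀ δ).prod
      (isCompact_Icc (a := a) (b := x₀))).exists_bound_of_continuousOn
      (hM'.mono fun p hp => huv ⟨hδu hp.1, hxv hp.2⟩)
    have hsub : uIoc a x₀ ⊆ Icc a x₀ := by
      rw [uIoc_of_le ha]; exact Ioc_subset_Icc_self
    refine (intervalIntegral.hasDerivAt_integral_of_dominated_loc_of_deriv_le
      (F := M) (F' := M') (bound := fun _ => B) (Metric.closedBall_mem_nhds x₀ hδ) ?_
      (hintM x₀ hx₀u) ?_ ?_ (by simp) ?_).2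
    · filter_upwards [hu.mem_nhds hx₀u] with x hx
      exact (intervalIntegrable_iff.1 (hintM x hx)).aestronglyMeasurable
    · exact (intervalIntegrable_iff.1
        (hcont' x₀ hx₀u _ hseg).intervalIntegrable).aestronglyMeasurable
    · exact Eventually.of_forall fun y hy x hx => hB (x, y) ⟨hx, hsub hy⟩
    · exact Eventually.of_forall fun y hy x hx => hd x y (huv ⟨hδu hx, hxv (hsub hy)⟩)
  have hvar : HasDerivAt (fun x => ∫ y in x₀..x, M x y) (M x₀ x₀) x₀ := by
    rw [hasDerivAt_iff_isLittleO, Asymptotics.isLittleO_iff]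
    intro ε hε
    have hc := (hM.continuousAt (hΩ.mem_nhds (hmem x₀ ⟨ha, le_rfl⟩)))
    obtain ⟨r, hr, hrM⟩ := Metric.continuousAt_iff.1 hc ε hε
    filter_upwards [Metric.ball_mem_nhds x₀ hr, hu.mem_nhds hx₀u,
      Metric.closedBall_mem_nhds x₀ hη] with x hx hxu' hxη
    have hint : IntervalIntegrable (M x) volume x₀ x :=
      (hcont x hxu' _ (hseg' x hxη)).intervalIntegrable
    have heq : (∫ y in x₀..x, M x y) - (∫ y in x₀..x₀, M x₀ y) - (x - x₀) • M x₀ x₀ =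
        ∫ y in x₀..x, (M x y - M x₀ x₀) := by
      rw [intervalIntegral.integral_sub hint (by simp)]; simp
    rw [heq, Real.norm_eq_abs (x - x₀)]
    refine intervalIntegral.norm_integral_le_of_norm_le_const fun y hy => ?_
    have hy' : y ∈ Metric.ball x₀ r :=
      (convex_ball x₀ r).ordConnected.uIcc_subset (Metric.mem_ball_self hr) hx
        (uIoc_subset_uIcc hy)
    exact (hrM (x := (x, y)) (by simpa [Prod.dist_eq] using ⟨hx, hy'⟩)).le
  have hsum := hfix.add hvar
  rw [add_comm (∫ y in a..x₀, M' x₀ y)] at hsum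
  refine hsum.congr_of_eventuallyEq ?_
  filter_upwards [hu.mem_nhds hx₀u, Metric.closedBall_mem_nhds x₀ hη] with x hxu' hxη
  exact (intervalIntegral.integral_add_adjacent_intervals (hintM x hxu')
    (hcont x hxu' _ (hseg' x hxη)).intervalIntegrable).symm

/-- Polynomial growth of a coefficient sequence. -/
def PolyBounded (g : ℕ → ℝ) : Prop := ∃ (B : ℝ) (m : ℕ), ∀ n, |g n| ≤ B * ((n : ℝ) + 1) ^ m

/-- Coefficients of the termwise derivative of `∑ g n * z ^ n`. -/
def derivCoeff (g : ℕ → ℝ) (n : ℕ) : ℝ := ((n : ℝ) + 1) * g (n + 1)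

lemma polyBounded_derivCoeff {g : ℕ → ℝ} (hg : PolyBounded g) :
    PolyBounded (derivCoeff g) := by
  obtain ⟨B, m, h⟩ := hg
  have hB : 0 ≤ B := by simpa using (abs_nonneg _).trans (h 0)
  refine ⟨B * 2 ^ m, m + 1, fun n => ?_⟩
  have hn := h (n + 1)
  push_cast at hn
  rw [derivCoeff, abs_mul, abs_of_nonneg (by positivity)]
  have h2 : ((n : ℝ) + 1 + 1) ^ m ≤ (2 * ((n : ℝ) + 1)) ^ m := by
    gcongr; linarith [(Nat.cast_nonneg n : (0 : ℝ) ≤ n)]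
  calc ((n : ℝ) + 1) * |g (n + 1)| ≤ ((n : ℝ) + 1) * (B * (2 * ((n : ℝ) + 1)) ^ m) := by
        gcongr; exact hn.trans (by gcongr)
    _ = _ := by rw [mul_pow]; ring

lemma PolyBounded.summable_abs {g : ℕ → ℝ} (hg : PolyBounded g) {r : ℝ} (hr0 : 0 ≤ r)
    (hr : r < 1) : Summable fun n => |g n| * r ^ n := by
  obtain ⟨B, m, h⟩ := hg
  have hB : 0 ≤ B := by simpa using (abs_nonneg _).trans (h 0)
  have hs : Summable fun n : ℕ => ((n : ℝ) ^ m * r ^ n : ℝ) :=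
    summable_pow_mul_geometric_of_norm_lt_one m (by rwa [Real.norm_of_nonneg hr0])
  have hs2 : Summable fun n : ℕ => B * 2 ^ m * ((n : ℝ) ^ m * r ^ n) + |g 0| * 0 ^ n :=
    (hs.mul_left _).add ((summable_geometric_of_lt_one le_rfl one_pos).mul_left _)
  refine Summable.of_nonneg_of_le (fun n => by positivity) (fun n => ?_) hs2
  rcases n with _ | n
  · simp; positivity
  · have h2 : (((n + 1 : ℕ) : ℝ) + 1) ^ m ≤ (2 * ((n + 1 : ℕ) : ℝ)) ^ m := by
      gcongr; push_cast; linarith [(Nat.cast_nonneg n : (0 : ℝ) ≤ n)]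
    calc |g (n + 1)| * r ^ (n + 1) ≤ (B * (2 * ((n + 1 : ℕ) : ℝ)) ^ m) * r ^ (n + 1) := by
          gcongr; exact (h (n + 1)).trans (by gcongr)
      _ = _ := by rw [mul_pow]; simp; ring

lemma PolyBounded.summable {g : ℕ → ℝ} (hg : PolyBounded g) {z : ℝ} (hz : |z| < 1) :
    Summable fun n => g n * z ^ n := by
  refine Summable.of_norm ?_
  simpa [abs_mul, abs_pow] using hg.summable_abs (abs_nonneg z) hz

lemma PolyBounded.hasDerivAt {g : ℕ → ℝ} (hg : PolyBounded g) {z : ℝ} (hz : |z| < 1) :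
    HasDerivAt (fun z => ∑' n, g n * z ^ n) (∑' n, derivCoeff g n * z ^ n) z := by
  obtain ⟨r, hzr, hr⟩ := exists_between hz
  have hr0 : 0 < r := (abs_nonneg z).trans_lt hzr
  have hs := (polyBounded_derivCoeff hg).summable_abs hr0.le hr
  have hs' : Summable fun n : ℕ => |g n| * n * r ^ (n - 1) := by
    rw [← summable_nat_add_iff 1]
    refine hs.congr fun n => ?_
    rw [derivCoeff, abs_mul, abs_of_nonneg (by positivity : (0 : ℝ) ≤ (n : ℝ) + 1)]
    simp only [Nat.add_sub_cancel, Nat.cast_add, Nat.cast_one]; ring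
  have hz' : z ∈ Metric.ball (0 : ℝ) r := by simpa using hzr
  have key := hasDerivAt_tsum_of_isPreconnected (g := fun n z => g n * z ^ n)
    (g' := fun n z => g n * (n * z ^ (n - 1))) hs' Metric.isOpen_ball
    (convex_ball (0 : ℝ) r).isPreconnected
    (fun n y _ => (hasDerivAt_pow n y).const_mul _)
    (fun n y hy => by
      have hy' : |y| ≤ r := by simpa using (Metric.mem_ball.1 hy).le
      simp only [norm_mul, norm_pow, Real.norm_eq_abs, Nat.abs_cast, ← mul_assoc]
      gcongr)
    (Metric.mem_ball_self hr0) (hg.summable (by simp)) hz'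
  convert! key using 1
  have hsz : Summable fun n : ℕ => g n * (n * z ^ (n - 1)) := by
    rw [← summable_nat_add_iff 1]
    refine ((polyBounded_derivCoeff hg).summable hz).congr fun n => ?_
    simp [derivCoeff]; ring
  rw [hsz.tsum_eq_zero_add]
  simp only [Nat.cast_zero, zero_mul, mul_zero, zero_add]
  refine tsum_congr fun n => ?_
  simp [derivCoeff]; ring

lemma PolyBounded.continuousOn {g : ℕ → ℝ} (hg : PolyBounded g) :
    ContinuousOn (fun z => ∑' n, g n * z ^ n) {z | |z| < 1} :=
  fun _ hz => (hg.hasDerivAt hz).continuousAt.continuousWithinAt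

lemma PolyBounded.hasSum_deriv_mul {g : ℕ → ℝ} (hg : PolyBounded g) {z : ℝ} (hz : |z| < 1) :
    HasSum (fun n : ℕ => (n : ℝ) * g n * z ^ n) (z * ∑' n, derivCoeff g n * z ^ n) := by
  rw [← hasSum_nat_add_iff' 1]
  simp only [Finset.range_one, Finset.sum_singleton, Nat.cast_zero, zero_mul, sub_zero]
  refine (((polyBounded_derivCoeff hg).summable hz).hasSum.mul_left z).congr_fun fun n => ?_
  simp [derivCoeff]; ring

/-- Coefficients of the hypergeometric series `₂F₁[a, b; 1; z]`. -/
noncomputable def hyp1Coeff (a b : ℝ) (n : ℕ) : ℝ :=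
  ((ascPochhammer ℝ n).eval a * (ascPochhammer ℝ n).eval b) / ((Nat.factorial n : ℝ) ^ 2)

lemma hyp1Coeff_succ (a b : ℝ) (n : ℕ) :
    ((n : ℝ) + 1) ^ 2 * hyp1Coeff a b (n + 1) = (a + n) * (b + n) * hyp1Coeff a b n := by
  have : (Nat.factorial n : ℝ) ≠ 0 := by positivity
  simp only [hyp1Coeff, ascPochhammer_succ_eval, Nat.factorial_succ]
  push_cast
  field_simp

lemma polyBounded_hyp1Coeff {a b : ℝ} (ha : |a| ≤ 1) (hb : |b| ≤ 1) :
    PolyBounded (hyp1Coeff a b) := by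
  refine ⟨1, 0, fun n => ?_⟩
  simp only [pow_zero, mul_one]
  induction n with
  | zero => simp [hyp1Coeff]
  | succ n ih =>
    have h := hyp1Coeff_succ a b n
    have hn : (0 : ℝ) ≤ n := Nat.cast_nonneg n
    have h1 : |a + n| ≤ n + 1 := by
      rw [abs_le] at *; constructor <;> linarith [ha.1, ha.2]
    have h2 : |b + n| ≤ n + 1 := by
      rw [abs_le] at *; constructor <;> linarith [hb.1, hb.2]
    have h3 : ((n : ℝ) + 1) ^ 2 * |hyp1Coeff a b (n + 1)| ≤ ((n : ℝ) + 1) ^ 2 * 1 := by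
      rw [← abs_of_nonneg (by positivity : (0 : ℝ) ≤ ((n : ℝ) + 1) ^ 2), ← abs_mul, h, abs_mul,
        abs_mul, abs_of_nonneg (by positivity : (0 : ℝ) ≤ ((n : ℝ) + 1) ^ 2), pow_two]
      gcongr
    exact le_of_mul_le_mul_left h3 (by positivity)

/-- The hypergeometric differential equation for `₂F₁[a, b; 1; z]`. -/
lemma hyp1_ode {a b : ℝ} (hg : PolyBounded (hyp1Coeff a b)) {z : ℝ} (hz : |z| < 1) :
    z * (1 - z) * ∑' n, derivCoeff (derivCoeff (hyp1Coeff a b)) n * z ^ n +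
      (1 - (a + b + 1) * z) * ∑' n, derivCoeff (hyp1Coeff a b) n * z ^ n -
      a * b * ∑' n, hyp1Coeff a b n * z ^ n = 0 := by
  set g := hyp1Coeff a b
  have s0 := (hg.summable hz).hasSum
  have s1 := ((polyBounded_derivCoeff hg).summable hz).hasSum
  have s1z := hg.hasSum_deriv_mul hz
  have s2z := (polyBounded_derivCoeff hg).hasSum_deriv_mul hz
  have s2zz : HasSum (fun n : ℕ => (n : ℝ) * (n - 1) * g n * z ^ n)
      (z * (z * ∑' n, derivCoeff (derivCoeff g) n * z ^ n)) := by
    rw [← hasSum_nat_add_iff' 1]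
    simp only [Finset.range_one, Finset.sum_singleton, Nat.cast_zero, zero_mul, sub_zero]
    refine (s2z.mul_left z).congr_fun fun n => ?_
    simp [derivCoeff]; ring
  have := ((((s2z.sub s2zz).add s1).sub (s1z.mul_left (a + b + 1))).sub (s0.mul_left (a * b)))
  have h0 : HasSum (fun _ : ℕ => (0 : ℝ)) _ := this.congr_fun fun n => by
    have := hyp1Coeff_succ a b n
    simp only [derivCoeff]
    linear_combination (-z ^ n) * this
  have := h0.unique hasSum_zero
  linear_combination this

lemma derivCoeff_hyp1Coeff (a b : ℝ) (n : ℕ) :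
    derivCoeff (hyp1Coeff a b) n = a * b *
      (((ascPochhammer ℝ n).eval (a + 1) * (ascPochhammer ℝ n).eval (b + 1)) /
        ((ascPochhammer ℝ n).eval 2 * (Nat.factorial n : ℝ))) := by
  have hs : ∀ x : ℝ, (ascPochhammer ℝ (n + 1)).eval x = x * (ascPochhammer ℝ n).eval (x + 1) := by
    intro x; simp [ascPochhammer_succ_left]
  have h2 : (ascPochhammer ℝ n).eval 2 = (Nat.factorial (n + 1) : ℝ) := by
    have := hs 1
    rw [ascPochhammer_eval_one, one_add_one_eq_two, one_mul] at this
    exact this.symm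
  have : (Nat.factorial n : ℝ) ≠ 0 := by positivity
  rw [derivCoeff, hyp1Coeff, hs, hs, h2, Nat.factorial_succ]
  push_cast
  field_simp

/-- Pairs `(x, y)` for which `r = cos (x / 2) / cos (y / 2)` satisfies `0 < r` and `r ^ 2 < 2`. -/
def ratioDomain : Set (ℝ × ℝ) :=
  {p | 0 < Real.cos (p.1 / 2) ∧ 0 < Real.cos (p.2 / 2) ∧
    Real.cos (p.1 / 2) ^ 2 < 2 * Real.cos (p.2 / 2) ^ 2}

lemma isOpen_ratioDomain : IsOpen ratioDomain := by
  simp only [ratioDomain, ofPred_and]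
  refine (isOpen_lt ?_ ?_).inter ((isOpen_lt ?_ ?_).inter (isOpen_lt ?_ ?_)) <;> fun_prop

lemma mem_ratioDomain {x y : ℝ} (hx : x < Real.pi) (hy : 0 ≤ y) (hyx : y ≤ x) :
    (x, y) ∈ ratioDomain := by
  have h1 : 0 < Real.cos (x / 2) := Real.cos_pos_of_mem_Ioo ⟨by linarith, by linarith⟩
  have h2 : Real.cos (x / 2) ≤ Real.cos (y / 2) :=
    Real.cos_le_cos_of_nonneg_of_le_pi (by linarith) (by linarith) (by linarith)
  refine ⟨h1, h1.trans_le h2, ?_⟩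
  simp only
  nlinarith

lemma ratio_mem {p : ℝ × ℝ} (hp : p ∈ ratioDomain) :
    Real.cos (p.1 / 2) / Real.cos (p.2 / 2) ∈ {r : ℝ | 0 < r ∧ r ^ 2 < 2} := by
  obtain ⟨h1, h2, h3⟩ := hp
  refine ⟨div_pos h1 h2, ?_⟩
  rwa [div_pow, div_lt_iff₀ (by positivity)]

lemma hasDerivAt_cos_half (x : ℝ) :
    HasDerivAt (fun x => Real.cos (x / 2)) (-(1 / 2) * Real.sin (x / 2)) x := by
  have := ((hasDerivAt_id x).div_const 2).cos
  convert! this using 1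
  simp; ring

lemma hasDerivAt_sin_half (x : ℝ) :
    HasDerivAt (fun x => Real.sin (x / 2)) ((1 / 2) * Real.cos (x / 2)) x := by
  have := ((hasDerivAt_id x).div_const 2).sin
  convert! this using 1
  simp; ring

lemma hasDerivAt_ratio_left (x y : ℝ) :
    HasDerivAt (fun x => Real.cos (x / 2) / Real.cos (y / 2))
      (-(1 / 2) * Real.sin (x / 2) / Real.cos (y / 2)) x :=
  (hasDerivAt_cos_half x).div_const _

lemma hasDerivAt_ratio_right (x : ℝ) {y : ℝ} (hy : Real.cos (y / 2) ≠ 0) :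
    HasDerivAt (fun y => Real.cos (x / 2) / Real.cos (y / 2))
      ((1 / 2) * Real.cos (x / 2) * Real.sin (y / 2) / Real.cos (y / 2) ^ 2) y := by
  have := (hasDerivAt_const y (Real.cos (x / 2))).div (hasDerivAt_cos_half y) hy
  convert! this using 1
  ring

lemma continuousOn_comp_ratio {f : ℝ → ℝ} (hf : ContinuousOn f {r : ℝ | 0 < r ∧ r ^ 2 < 2}) :
    ContinuousOn (fun p : ℝ × ℝ => f (Real.cos (p.1 / 2) / Real.cos (p.2 / 2))) ratioDomain :=
  hf.comp (ContinuousOn.div (by fun_prop) (by fun_prop) fun _ hp => hp.2.1.ne')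
    fun _ hp => ratio_mem hp

/-- A kernel `k (cos (x / 2) / cos (y / 2))` with `k` satisfying a suitable second order equation
transmutes `cos (c * y)` into a solution of `V'' = -(c ^ 2 - m / (4 cos ^ 2 (x / 2))) V`. -/
lemma transmutation {k k₁ k₂ : ℝ → ℝ} {m : ℝ}
    (hk : ∀ r, 0 < r → r ^ 2 < 2 → HasDerivAt k (k₁ r) r)
    (hk₁ : ∀ r, 0 < r → r ^ 2 < 2 → HasDerivAt k₁ (k₂ r) r)
    (hk₂ : ContinuousOn k₂ {r : ℝ | 0 < r ∧ r ^ 2 < 2})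
    (hode : ∀ r, 0 < r → r ^ 2 < 2 → k₂ r * r ^ 2 * (1 - r ^ 2) - 2 * k₁ r * r ^ 3 = m * k r)
    (hone : k 1 = 1) (c : ℝ) {x : ℝ} (hx0 : 0 ≤ x) (hxπ : x < Real.pi) :
    HasDerivAt
        (fun x => ∫ y in (0 : ℝ)..x, k (Real.cos (x / 2) / Real.cos (y / 2)) * Real.cos (c * y))
        (Real.cos (c * x) + ∫ y in (0 : ℝ)..x, -(1 / 2) * Real.sin (x / 2) / Real.cos (y / 2) *
          k₁ (Real.cos (x / 2) / Real.cos (y / 2)) * Real.cos (c * y)) x ∧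
      HasDerivAt
        (fun x => Real.cos (c * x) + ∫ y in (0 : ℝ)..x,
          -(1 / 2) * Real.sin (x / 2) / Real.cos (y / 2) *
            k₁ (Real.cos (x / 2) / Real.cos (y / 2)) * Real.cos (c * y))
        (-(c ^ 2 - m / (4 * Real.cos (x / 2) ^ 2)) *
          ∫ y in (0 : ℝ)..x, k (Real.cos (x / 2) / Real.cos (y / 2)) * Real.cos (c * y)) x := by
  set M : ℝ → ℝ → ℝ := fun x y => k (Real.cos (x / 2) / Real.cos (y / 2)) * Real.cos (c * y)
    with hMdef
  set M₁ : ℝ → ℝ → ℝ := fun x y => -(1 / 2) * Real.sin (x / 2) / Real.cos (y / 2) *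
            k₁ (Real.cos (x / 2) / Real.cos (y / 2)) * Real.cos (c * y) with hM1def
  set M₂ : ℝ → ℝ → ℝ := fun x y =>
    (k₂ (Real.cos (x / 2) / Real.cos (y / 2)) *
      (-(1 / 2) * Real.sin (x / 2) / Real.cos (y / 2)) ^ 2 -
      (1 / 4) * (Real.cos (x / 2) / Real.cos (y / 2)) *
      k₁ (Real.cos (x / 2) / Real.cos (y / 2))) * Real.cos (c * y) with hM2def
  have hkc : ContinuousOn k {r : ℝ | 0 < r ∧ r ^ 2 < 2} := fun r hr =>
    (hk r hr.1 hr.2).continuousAt.continuousWithinAt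
  have hk1c : ContinuousOn k₁ {r : ℝ | 0 < r ∧ r ^ 2 < 2} := fun r hr =>
    (hk₁ r hr.1 hr.2).continuousAt.continuousWithinAt
  have hsc : ContinuousOn (fun p : ℝ × ℝ => -(1 / 2) * Real.sin (p.1 / 2) / Real.cos (p.2 / 2))
      ratioDomain :=
    ContinuousOn.div (by fun_prop) (by fun_prop) fun _ hp => hp.2.1.ne'
  have hcc : ContinuousOn (fun p : ℝ × ℝ => Real.cos (p.1 / 2) / Real.cos (p.2 / 2))
      ratioDomain :=
    ContinuousOn.div (by fun_prop) (by fun_prop) fun _ hp => hp.2.1.ne'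
  have hcos : ContinuousOn (fun p : ℝ × ℝ => Real.cos (c * p.2)) ratioDomain := by fun_prop
  have hMc : ContinuousOn (fun p : ℝ × ℝ => M p.1 p.2) ratioDomain :=
    (continuousOn_comp_ratio hkc).mul hcos
  have hM1c : ContinuousOn (fun p : ℝ × ℝ => M₁ p.1 p.2) ratioDomain :=
    (hsc.mul (continuousOn_comp_ratio hk1c)).mul hcos
  have hM2c : ContinuousOn (fun p : ℝ × ℝ => M₂ p.1 p.2) ratioDomain :=
    (((continuousOn_comp_ratio hk₂).mul (hsc.pow 2)).sub
      ((continuousOn_const.mul hcc).mul (continuousOn_comp_ratio hk1c))).mul hcos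
  have hd : ∀ x y, (x, y) ∈ ratioDomain → HasDerivAt (fun x => M x y) (M₁ x y) x := by
    intro x y hp
    have hr := ratio_mem hp
    have := ((hk _ hr.1 hr.2).comp x (hasDerivAt_ratio_left x y)).mul_const (Real.cos (c * y))
    convert! this using 1
    simp only [hM1def]; ring
  have hd1 : ∀ x y, (x, y) ∈ ratioDomain → HasDerivAt (fun x => M₁ x y) (M₂ x y) x := by
    intro x y hp
    have hr := ratio_mem hp
    have := ((((hasDerivAt_sin_half x).const_mul (-(1 / 2))).div_const (Real.cos (y / 2))).mul
      ((hk₁ _ hr.1 hr.2).comp x (hasDerivAt_ratio_left x y))).mul_const (Real.cos (c * y))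
    convert! this using 1
    simp only [hM2def, Function.comp]; ring
  have hmem : ∀ y ∈ Icc 0 x, (x, y) ∈ ratioDomain := fun y hy => mem_ratioDomain hxπ hy.1 hy.2
  have hcx : 0 < Real.cos (x / 2) := (hmem x ⟨hx0, le_rfl⟩).1
  have hV := hasDerivAt_integral_variable_endpoint isOpen_ratioDomain hMc hM1c hd hx0 hmem
  have hU := (hasDerivAt_integral_variable_endpoint isOpen_ratioDomain hM1c hM2c hd1 hx0 hmem)
  refine ⟨?_, ?_⟩
  · have hdiag : M x x = Real.cos (c * x) := by simp [hMdef, div_self hcx.ne', hone]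
    rwa [hdiag] at hV
  · have hcosd : HasDerivAt (fun x => Real.cos (c * x)) (-c * Real.sin (c * x)) x := by
      have := ((hasDerivAt_id x).const_mul c).cos
      convert! this using 1
      simp; ring
    have hslice : ∀ {N : ℝ → ℝ → ℝ}, ContinuousOn (fun p : ℝ × ℝ => N p.1 p.2) ratioDomain →
        ContinuousOn (N x) (uIcc 0 x) := fun hN => by
      rw [uIcc_of_le hx0]
      exact hN.comp (f := fun y => (x, y)) (by fun_prop) hmem
    have hint : IntervalIntegrable (M x) volume 0 x := (hslice hMc).intervalIntegrable
    have hint2 : IntervalIntegrable (M₂ x) volume 0 x := (hslice hM2c).intervalIntegrable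
    have hparts : (∫ y in (0 : ℝ)..x, (M₂ x y + (c ^ 2 - m / (4 * Real.cos (x / 2) ^ 2)) * M x y)) =
        (1 / 2) * Real.sin (x / 2) / Real.cos (x / 2) * k₁ 1 * Real.cos (c * x) +
          c * Real.sin (c * x) := by
      have := intervalIntegral.integral_eq_sub_of_hasDerivAt (a := 0) (b := x)
        (f := fun y => (1 / 2) * Real.cos (x / 2) * Real.sin (y / 2) / Real.cos (y / 2) ^ 2 *
          k₁ (Real.cos (x / 2) / Real.cos (y / 2)) * Real.cos (c * y) +
          c * (k (Real.cos (x / 2) / Real.cos (y / 2)) * Real.sin (c * y)))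
        (f' := fun y => M₂ x y + (c ^ 2 - m / (4 * Real.cos (x / 2) ^ 2)) * M x y) ?_
        (hint2.add (hint.const_mul _))
      · rw [this]
        simp [div_self hcx.ne', hone]
        left; left
        field_simp
      · intro y hy
        rw [uIcc_of_le hx0] at hy
        have hp := hmem y hy
        have hr := ratio_mem hp
        have hcy : 0 < Real.cos (y / 2) := hp.2.1
        have hρ := hasDerivAt_ratio_right x hcy.ne'
        have hcosy : HasDerivAt (fun y => Real.cos (c * y)) (-c * Real.sin (c * y)) y := by
          have := ((hasDerivAt_id y).const_mul c).cos
          convert! this using 1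
          simp; ring
        have hsiny : HasDerivAt (fun y => Real.sin (c * y)) (c * Real.cos (c * y)) y := by
          have := ((hasDerivAt_id y).const_mul c).sin
          convert! this using 1
          simp; ring
        have h1 := ((((hasDerivAt_sin_half y).const_mul ((1 / 2) * Real.cos (x / 2))).div
          ((hasDerivAt_cos_half y).pow 2) (pow_pos hcy 2).ne').mul
          ((hk₁ _ hr.1 hr.2).comp y hρ)).mul hcosy
        have h2 := (((hk _ hr.1 hr.2).comp y hρ).mul hsiny).const_mul c
        convert! h1.add h2 using 1
        have ho := hode _ hr.1 hr.2
        simp only [hM2def, hMdef, Function.comp, Pi.mul_apply, Pi.div_apply, Pi.pow_apply]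
        have hsx : Real.sin (x / 2) ^ 2 = 1 - Real.cos (x / 2) ^ 2 := Real.sin_sq _
        have hsy : Real.sin (y / 2) ^ 2 = 1 - Real.cos (y / 2) ^ 2 := Real.sin_sq _
        simp only [] at ho
        generalize k (Real.cos (x / 2) / Real.cos (y / 2)) = K at *
        generalize k₁ (Real.cos (x / 2) / Real.cos (y / 2)) = K₁ at *
        generalize k₂ (Real.cos (x / 2) / Real.cos (y / 2)) = K₂ at *
        have hmK : m / (4 * Real.cos (x / 2) ^ 2) * K = (m * K) / (4 * Real.cos (x / 2) ^ 2) := by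
          ring
        have e : K₂ * (-(1 / 2) * Real.sin (x / 2) / Real.cos (y / 2)) ^ 2 -
            1 / 4 * (Real.cos (x / 2) / Real.cos (y / 2)) * K₁ -
            m / (4 * Real.cos (x / 2) ^ 2) * K =
            K₂ * (1 / 2 * Real.cos (x / 2) * Real.sin (y / 2) / Real.cos (y / 2) ^ 2) ^ 2 +
            K₁ * (1 / 4 * Real.cos (x / 2) * (2 - Real.cos (y / 2) ^ 2) /
              Real.cos (y / 2) ^ 3) := by
          rw [hmK, ← ho]
          simp only [div_pow, mul_pow, hsx, hsy]
          field_simp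
          ring
        have e2 : 1 / 4 * Real.cos (x / 2) * (2 - Real.cos (y / 2) ^ 2) / Real.cos (y / 2) ^ 3 =
            (1 / 2 * Real.cos (x / 2) * (1 / 2 * Real.cos (y / 2)) * Real.cos (y / 2) ^ 2 -
              1 / 2 * Real.cos (x / 2) * Real.sin (y / 2) *
              (2 * Real.cos (y / 2) * (-(1 / 2) * Real.sin (y / 2)))) /
              (Real.cos (y / 2) ^ 2) ^ 2 := by
          field_simp
          rw [hsy]
          ring
        rw [e2] at e
        simp only [Nat.cast_ofNat, Nat.add_one_sub_one, pow_one]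
        linear_combination Real.cos (c * y) * e
    have hsplit : ∫ y in (0 : ℝ)..x, M₂ x y =
        (1 / 2) * Real.sin (x / 2) / Real.cos (x / 2) * k₁ 1 * Real.cos (c * x) +
          c * Real.sin (c * x) -
        (c ^ 2 - m / (4 * Real.cos (x / 2) ^ 2)) * ∫ y in (0 : ℝ)..x, M x y := by
      rw [← hparts, intervalIntegral.integral_add hint2 (hint.const_mul _),
        intervalIntegral.integral_const_mul]
      ring
    convert! hcosd.add hU using 1
    rw [hsplit]
    simp only [hM1def, div_self hcx.ne']
    ring

lemma genBinom_pos {a : ℝ} {m : ℕ} (h : (m : ℝ) - 1 < a) : 0 < genBinom a m := by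
  have hm : (0 : ℝ) ≤ m := Nat.cast_nonneg m
  exact div_pos (Real.Gamma_pos_of_pos (by linarith))
    (mul_pos (Real.Gamma_pos_of_pos (by linarith)) (Real.Gamma_pos_of_pos (by linarith)))

lemma genBinom_succ {a : ℝ} {m : ℕ} (h : (m : ℝ) < a) :
    ((m : ℝ) + 1) * genBinom a (m + 1) = (a - m) * genBinom a m := by
  have h1 : Real.Gamma ((m : ℝ) + 1 + 1) = ((m : ℝ) + 1) * Real.Gamma ((m : ℝ) + 1) :=
    Real.Gamma_add_one (by positivity)
  have h2 : Real.Gamma (a - m + 1) = (a - m) * Real.Gamma (a - m) :=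
    Real.Gamma_add_one (by linarith)
  have h3 : a - ((m : ℝ) + 1) + 1 = a - m := by ring
  have p1 : Real.Gamma ((m : ℝ) + 1) ≠ 0 := (Real.Gamma_pos_of_pos (by positivity)).ne'
  have p2 : Real.Gamma (a - m) ≠ 0 := (Real.Gamma_pos_of_pos (by linarith)).ne'
  have p3 : a - m ≠ 0 := by linarith
  simp only [genBinom]
  push_cast
  rw [h1, h3, h2]
  field_simp

open Polynomial in
/-- The Jacobi polynomial as a polynomial in the variable `(x - 1) / 2`. -/
noncomputable def jacobiPoly (α β : ℝ) (k : ℕ) : ℝ[X] :=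
  ∑ s ∈ Finset.range (k + 1),
    C (genBinom ((k : ℝ) + α) (k - s) * genBinom ((k : ℝ) + β) s) * (X ^ s * (X + 1) ^ (k - s))

lemma jacobiP_eq_eval (α β : ℝ) (k : ℕ) (x : ℝ) :
    jacobiP α β k x = (jacobiPoly α β k).eval ((x - 1) / 2) := by
  simp only [jacobiP, jacobiPoly, Polynomial.eval_finsetSum]
  refine Finset.sum_congr rfl fun s _ => ?_
  simp only [Polynomial.eval_mul, Polynomial.eval_C, Polynomial.eval_pow, Polynomial.eval_X,
    Polynomial.eval_add, Polynomial.eval_one]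
  rw [show (x - 1) / 2 + 1 = (x + 1) / 2 by ring]
  ring

lemma jacobiP_one_pos {α β : ℝ} (hα : -1 < α) (hβ : -1 < β) (k : ℕ) : 0 < jacobiP α β k 1 := by
  have hk : (0 : ℝ) ≤ k := Nat.cast_nonneg k
  rw [jacobiP, Finset.sum_range_succ', Finset.sum_eq_zero (by simp)]
  have h1 : 0 < genBinom ((k : ℝ) + α) k := genBinom_pos (by linarith)
  have h2 : 0 < genBinom ((k : ℝ) + β) 0 := genBinom_pos (by push_cast; linarith)
  simpa using mul_pos h1 h2

open Polynomial in
/-- The Jacobi operator on the basis `X ^ i * (X + 1) ^ j`. -/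
lemma jacobi_operator_basis (α β : ℝ) (i j : ℕ) :
    X * (X + 1) * derivative (derivative (X ^ i * (X + 1) ^ j : ℝ[X])) +
      (C (α + 1) + C (α + β + 2) * X) * derivative (X ^ i * (X + 1) ^ j) -
      C ((i + j : ℝ) * (i + j + α + β + 1)) * (X ^ i * (X + 1) ^ j) =
    C ((i : ℝ) * (i + α)) * (X ^ (i - 1) * (X + 1) ^ j) -
      C ((j : ℝ) * (j + β)) * (X ^ i * (X + 1) ^ (j - 1)) := by
  rcases i with _ | _ | i <;> rcases j with _ | _ | j <;>
    simp [derivative_pow, map_ofNat] <;> ring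

open Polynomial in
lemma jacobiPoly_ode {α β : ℝ} (hα : -1 < α) (hβ : -1 < β) (k : ℕ) :
    X * (X + 1) * derivative (derivative (jacobiPoly α β k)) +
      (C (α + 1) + C (α + β + 2) * X) * derivative (jacobiPoly α β k) -
      C ((k : ℝ) * (k + α + β + 1)) * jacobiPoly α β k = 0 := by
  set a : ℕ → ℝ := fun s => genBinom ((k : ℝ) + α) (k - s) * genBinom ((k : ℝ) + β) s with ha
  have hrec : ∀ s < k, a (s + 1) * ((s + 1 : ℝ) * (s + 1 + α)) =
      a s * ((k - s : ℝ) * (k - s + β)) := by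
    intro s hs
    obtain ⟨j, rfl⟩ : ∃ j, k = s + 1 + j := ⟨k - (s + 1), by omega⟩
    have e1 : s + 1 + j - s = j + 1 := by omega
    have e2 : s + 1 + j - (s + 1) = j := by omega
    have hs0 : (0 : ℝ) ≤ s := Nat.cast_nonneg s
    have hj0 : (0 : ℝ) ≤ j := Nat.cast_nonneg j
    have h1 := genBinom_succ (a := ((s + 1 + j : ℕ) : ℝ) + α) (m := j) (by push_cast; linarith)
    have h2 := genBinom_succ (a := ((s + 1 + j : ℕ) : ℝ) + β) (m := s) (by push_cast; linarith)
    simp only [ha, e1, e2]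
    push_cast at h1 h2 ⊢
    linear_combination genBinom ((s : ℝ) + 1 + j + α) j * (s + 1 + α) * h2 -
      genBinom ((s : ℝ) + 1 + j + β) s * (j + 1 + β) * h1
  set t : ℕ → ℝ[X] := fun s => C (a s * ((s : ℝ) * (s + α))) * (X ^ (s - 1) * (X + 1) ^ (k - s))
    with ht
  set b : ℕ → ℝ[X] := fun s =>
    C (a s * ((k - s : ℝ) * (k - s + β))) * (X ^ s * (X + 1) ^ (k - s - 1)) with hb
  have hterm : ∀ s ∈ Finset.range (k + 1),
      X * (X + 1) * derivative (derivative (C (a s) * (X ^ s * (X + 1) ^ (k - s)))) +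
      (C (α + 1) + C (α + β + 2) * X) * derivative (C (a s) * (X ^ s * (X + 1) ^ (k - s))) -
      C ((k : ℝ) * (k + α + β + 1)) * (C (a s) * (X ^ s * (X + 1) ^ (k - s))) = t s - b s := by
    intro s hs
    have hsk : s ≤ k := by simpa [Nat.lt_succ_iff] using hs
    have := jacobi_operator_basis α β s (k - s)
    rw [Nat.cast_sub hsk] at this
    simp only [add_sub_cancel] at this
    simp only [derivative_C_mul, ht, hb, C_mul (a := a s)]
    linear_combination C (a s) * this
  have hshift : ∀ s ∈ Finset.range k, t (s + 1) = b s := by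
    intro s hs
    simp only [ht, hb]
    push_cast
    rw [hrec s (by simpa using hs), Nat.sub_add_eq]
  simp only [jacobiPoly, derivative_sum, Finset.mul_sum, ← Finset.sum_add_distrib,
    ← Finset.sum_sub_distrib]
  rw [Finset.sum_congr rfl hterm, Finset.sum_sub_distrib, Finset.sum_range_succ',
    Finset.sum_range_succ (f := b), Finset.sum_congr rfl hshift]
  simp [ht, hb]

/-- Uniqueness for a linear first order system of two equations with zero initial data. -/
lemma linear_system_eq_zero {f g a b d : ℝ → ℝ} {x₀ x₁ : ℝ} (hx : x₀ ≤ x₁)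
    (ha : ContinuousOn a (Icc x₀ x₁)) (hb : ContinuousOn b (Icc x₀ x₁))
    (hd : ContinuousOn d (Icc x₀ x₁))
    (hf : ∀ x ∈ Icc x₀ x₁, HasDerivAt f (a x * g x) x)
    (hg : ∀ x ∈ Icc x₀ x₁, HasDerivAt g (b x * g x + d x * f x) x)
    (hf0 : f x₀ = 0) (hg0 : g x₀ = 0) : g x₁ = 0 := by
  obtain ⟨A, hA⟩ := isCompact_Icc.exists_bound_of_continuousOn ha
  obtain ⟨B, hB⟩ := isCompact_Icc.exists_bound_of_continuousOn hb
  obtain ⟨D, hD⟩ := isCompact_Icc.exists_bound_of_continuousOn hd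
  have h := norm_le_gronwallBound_of_norm_deriv_right_le (f := fun x => (f x, g x))
    (f' := fun x => (a x * g x, b x * g x + d x * f x)) (δ := 0) (K := A + B + D) (ε := 0)
    (a := x₀) (b := x₁)
    (fun x hx => ((hf x hx).continuousAt.prodMk (hg x hx).continuousAt).continuousWithinAt)
    (fun x hx => ((hf x (Ico_subset_Icc_self hx)).prodMk
      (hg x (Ico_subset_Icc_self hx))).hasDerivWithinAt)
    (by simp [hf0, hg0]) (fun x hx => ?_) x₁ ⟨hx, le_rfl⟩
  · rw [gronwallBound_ε0_δ0] at h
    have h' := (norm_snd_le _).trans h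
    simpa using h'
  · have hx' := Ico_subset_Icc_self hx
    have hA' := hA x hx'
    have hB' := hB x hx'
    have hD' := hD x hx'
    set n := ‖(f x, g x)‖ with hn
    have hfn : ‖f x‖ ≤ n := norm_fst_le (f x, g x)
    have hgn : ‖g x‖ ≤ n := norm_snd_le (f x, g x)
    have hn0 : 0 ≤ n := norm_nonneg _
    have hA0 := (norm_nonneg _).trans hA'
    have hB0 := (norm_nonneg _).trans hB'
    have hD0 := (norm_nonneg _).trans hD'
    have m1 : ‖a x * g x‖ ≤ A * n := by rw [norm_mul]; gcongr
    have m2 : ‖b x * g x‖ ≤ B * n := by rw [norm_mul]; gcongr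
    have m3 : ‖d x * f x‖ ≤ D * n := by rw [norm_mul]; gcongr
    have m4 := norm_add_le (b x * g x) (d x * f x)
    rw [add_zero]
    refine norm_prod_le_iff.2 ⟨?_, ?_⟩
    · dsimp only; nlinarith
    · dsimp only; nlinarith

lemma hasDerivAt_jacobi_system {β : ℝ} (hβ : -1 < β) (k : ℕ) {μ : ℝ}
    (hμ : μ = (2 * k + 1) * (2 * k + 2 * β)) (hμ0 : μ ≠ 0) {x : ℝ} (hx : Real.cos (x / 2) ≠ 0) :
    let Q := jacobiPoly (-(1 / 2)) β k
    let R : ℝ → ℝ := fun x => Q.eval (-(Real.sin (x / 2) ^ 2))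
    let J : ℝ → ℝ := fun x => 4 / μ * (β * (Real.sin (x / 2) * R x) +
      Real.cos (x / 2) ^ 2 * (Real.sin (x / 2) * Q.derivative.eval (-(Real.sin (x / 2) ^ 2))))
    HasDerivAt J (Real.cos (x / 2) * R x) x ∧
      HasDerivAt R (β * Real.sin (x / 2) / Real.cos (x / 2) * R x +
        -(μ / (4 * Real.cos (x / 2))) * J x) x := by
  intro Q R J
  have hu : HasDerivAt (fun x => -(Real.sin (x / 2) ^ 2))
      (-(Real.sin (x / 2) * Real.cos (x / 2))) x := by
    convert! ((hasDerivAt_sin_half x).pow 2).neg using 1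
    simp; ring
  have hQ : ∀ q : Polynomial ℝ, HasDerivAt (fun x => q.eval (-(Real.sin (x / 2) ^ 2)))
      (q.derivative.eval (-(Real.sin (x / 2) ^ 2)) * -(Real.sin (x / 2) * Real.cos (x / 2))) x :=
    fun q => (q.hasDerivAt _).comp x hu
  have hode := congrArg (Polynomial.eval (-(Real.sin (x / 2) ^ 2)))
    (jacobiPoly_ode (α := -(1 / 2)) (by norm_num) hβ k)
  simp only [Polynomial.eval_sub, Polynomial.eval_add, Polynomial.eval_mul, Polynomial.eval_X,
    Polynomial.eval_C, Polynomial.eval_one, Polynomial.eval_zero] at hode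
  have hc : Real.cos (x / 2) ^ 2 = 1 - Real.sin (x / 2) ^ 2 := Real.cos_sq' _
  have hs := hasDerivAt_sin_half x
  constructor
  · have h1 := (((hs.mul (hQ Q)).const_mul β).add
      (((hasDerivAt_cos_half x).pow 2).mul (hs.mul (hQ Q.derivative)))).const_mul (4 / μ)
    convert! h1 using 1
    simp only [Pi.mul_apply, Pi.pow_apply, R]
    rw [eq_comm, div_mul_eq_mul_div, div_eq_iff hμ0, hμ]
    push_cast
    change _ - _ * Polynomial.eval _ Q = 0 at hode
    generalize Polynomial.eval (-(Real.sin (x / 2) ^ 2)) Q = q₀ at *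
    change _ * Polynomial.eval (-(Real.sin (x / 2) ^ 2)) Q.derivative.derivative +
      _ * Polynomial.eval _ Q.derivative - _ = 0 at hode
    generalize Polynomial.eval (-(Real.sin (x / 2) ^ 2)) Q.derivative = q₁ at *
    generalize Polynomial.eval (-(Real.sin (x / 2) ^ 2)) Q.derivative.derivative = q₂ at *
    simp only [pow_one]
    linear_combination (4 * Real.cos (x / 2)) * hode +
      (2 * Real.cos (x / 2) * q₁ - 4 * Real.cos (x / 2) * Real.sin (x / 2) ^ 2 * q₂) * hc
  · convert! hQ Q using 1
    simp only [J, R]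
    field_simp
    ring

lemma hasDerivAt_cos_half_rpow (e : ℝ) {x : ℝ} (hx : 0 < Real.cos (x / 2)) :
    HasDerivAt (fun x => Real.cos (x / 2) ^ e)
      (-(e / 2) * (Real.sin (x / 2) / Real.cos (x / 2)) * Real.cos (x / 2) ^ e) x := by
  convert! (hasDerivAt_cos_half x).rpow_const (p := e) (Or.inl hx.ne') using 1
  rw [Real.rpow_sub_one hx.ne']
  ring

/-- Passage from `V'' = -(c ^ 2 - s (s - 1) / (4 cos ^ 2 (x / 2))) V` to the Jacobi system. -/
lemma hasDerivAt_gauge {V U : ℝ → ℝ} {c s x : ℝ} (hx : 0 < Real.cos (x / 2))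
    (hV : HasDerivAt V (U x) x)
    (hU : HasDerivAt U (-(c ^ 2 - s * (s - 1) / (4 * Real.cos (x / 2) ^ 2)) * V x) x) :
    let J : ℝ → ℝ := fun x => Real.cos (x / 2) ^ (-s) * V x
    let D : ℝ → ℝ := fun x => Real.cos (x / 2) ^ (-s - 1) *
      (U x + s / 2 * (Real.sin (x / 2) / Real.cos (x / 2)) * V x)
    HasDerivAt J (Real.cos (x / 2) * D x) x ∧
      HasDerivAt D ((s + 1 / 2) * Real.sin (x / 2) / Real.cos (x / 2) * D x +
        -((4 * c ^ 2 - s ^ 2) / (4 * Real.cos (x / 2))) * J x) x := by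
  intro J D
  have hw : Real.cos (x / 2) ^ (-s) = Real.cos (x / 2) ^ (-s - 1) * Real.cos (x / 2) := by
    rw [← Real.rpow_add_one hx.ne']; ring_nf
  have hsq : Real.sin (x / 2) ^ 2 = 1 - Real.cos (x / 2) ^ 2 := Real.sin_sq _
  constructor
  · convert! (hasDerivAt_cos_half_rpow (-s) hx).mul hV using 1
    simp only [D, hw]
    field_simp
    ring
  · have ht := (hasDerivAt_sin_half x).div (hasDerivAt_cos_half x) hx.ne'
    convert! (hasDerivAt_cos_half_rpow (-s - 1) hx).mul
      (hU.add ((ht.const_mul (s / 2)).mul hV)) using 1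
    simp only [D, J, hw, Pi.add_apply, Pi.mul_apply, Pi.div_apply]
    generalize Real.cos (x / 2) ^ (-s - 1) = W at *
    generalize Real.sin (x / 2) = S at *
    generalize Real.cos (x / 2) = C at *
    field_simp
    ring_nf
    simp only [hsq]
    ring

/-- If `G` solves the hypergeometric equation with parameters `(s + 1) / 2, s / 2; 1`, then
`r ^ s * G (1 - r ^ 2)` solves the equation required of the kernel in `transmutation`. -/
lemma kernel_profile {s : ℝ} {G G₁ G₂ : ℝ → ℝ}
    (hG : ∀ z, |z| < 1 → HasDerivAt G (G₁ z) z) (hG₁ : ∀ z, |z| < 1 → HasDerivAt G₁ (G₂ z) z)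
    (hode : ∀ z, |z| < 1 → z * (1 - z) * G₂ z + (1 - (s + 3 / 2) * z) * G₁ z -
      s * (s + 1) / 4 * G z = 0) {r : ℝ} (hr : 0 < r) (hr2 : r ^ 2 < 2) :
    let k₁ : ℝ → ℝ := fun r => r ^ s * (s / r * G (1 - r ^ 2) - 2 * r * G₁ (1 - r ^ 2))
    let k₂ : ℝ → ℝ := fun r => r ^ s * (s * (s - 1) / r ^ 2 * G (1 - r ^ 2) -
      (4 * s + 2) * G₁ (1 - r ^ 2) + 4 * r ^ 2 * G₂ (1 - r ^ 2))
    HasDerivAt (fun r => r ^ s * G (1 - r ^ 2)) (k₁ r) r ∧ HasDerivAt k₁ (k₂ r) r ∧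
      k₂ r * r ^ 2 * (1 - r ^ 2) - 2 * k₁ r * r ^ 3 =
        s * (s - 1) * (r ^ s * G (1 - r ^ 2)) := by
  intro k₁ k₂
  have hz : |1 - r ^ 2| < 1 := by
    rw [abs_lt]; constructor <;> nlinarith
  have hq : HasDerivAt (fun r : ℝ => 1 - r ^ 2) (-(2 * r)) r := by
    convert! (hasDerivAt_pow 2 r).const_sub 1 using 1
    simp
  have hp : HasDerivAt (fun r : ℝ => r ^ s) (s / r * r ^ s) r := by
    convert! Real.hasDerivAt_rpow_const (p := s) (Or.inl hr.ne') using 1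
    rw [Real.rpow_sub_one hr.ne']; ring
  have h0 := (hG _ hz).comp r hq
  have h1 := (hG₁ _ hz).comp r hq
  refine ⟨?_, ?_, ?_⟩
  · convert! hp.mul h0 using 1
    simp only [k₁, Function.comp]
    ring
  · have hi : HasDerivAt (fun r : ℝ => s / r) (-s / r ^ 2) r := by
      convert! (hasDerivAt_const r s).div (hasDerivAt_id r) hr.ne' using 1
      simp
    convert! hp.mul ((hi.mul h0).sub (((hasDerivAt_id r).const_mul 2).mul h1)) using 1
    simp only [k₂, Function.comp, Pi.mul_apply, Pi.sub_apply, id]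
    field_simp
    ring
  · have ho := hode _ hz
    simp only [k₁, k₂]
    field_simp
    linear_combination (4 * r ^ 2) * ho

/-- **Limit case of the Dirichlet–Mehler type formula.** For `-1 < β < 0`,
`0 < θ < π` and `k ∈ ℕ₀`,
`R_k^{(-1/2,β)}(cos θ) = (cos(θ/2))^{-β-1/2} cos((k+β/2+1/4)θ)
  + (1/4)(β²-1/4) sin(θ/2) ∫_0^θ (cos(φ/2))^{-β-3/2} cos((k+β/2+1/4)φ)
      ₂F₁[β/2+5/4, β/2+3/4; 2; (cos φ - cos θ)/(1 + cos φ)] dφ`. -/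
theorem jacobiR_neg_half_dirichlet_mehler (β : ℝ) (hβ : -1 < β) (hβ0 : β < 0)
    (θ : ℝ) (hθ : 0 < θ) (hθπ : θ < Real.pi) (k : ℕ) :
    jacobiR (-(1/2)) β k (Real.cos θ) =
      Real.cos (θ / 2) ^ (-β - 1/2) * Real.cos (((k : ℝ) + β / 2 + 1/4) * θ) +
      (1/4) * (β ^ (2 : ℕ) - 1/4) * Real.sin (θ / 2) *
        ∫ φ in (0 : ℝ)..θ,
          Real.cos (φ / 2) ^ (-β - 3/2) * Real.cos (((k : ℝ) + β / 2 + 1/4) * φ) *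
            gauss2F1 (β / 2 + 5/4) (β / 2 + 3/4) 2
              ((Real.cos φ - Real.cos θ) / (1 + Real.cos φ)) := by
  have hcos : ∀ x ∈ Icc 0 θ, 0 < Real.cos (x / 2) := fun x hx =>
    Real.cos_pos_of_mem_Ioo ⟨by linarith [hx.1, Real.pi_pos], by linarith [hx.2]⟩
  set s : ℝ := β - 1 / 2 with hs
  set c : ℝ := (k : ℝ) + β / 2 + 1 / 4 with hc
  set g : ℕ → ℝ := hyp1Coeff (β / 2 + 1 / 4) (β / 2 - 1 / 4) with hgdef
  have hg : PolyBounded g := polyBounded_hyp1Coeff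
    (abs_le.2 ⟨by linarith, by linarith⟩) (abs_le.2 ⟨by linarith, by linarith⟩)
  set G : ℝ → ℝ := fun z => ∑' n, g n * z ^ n with hG
  set G₁ : ℝ → ℝ := fun z => ∑' n, derivCoeff g n * z ^ n with hG₁
  set G₂ : ℝ → ℝ := fun z => ∑' n, derivCoeff (derivCoeff g) n * z ^ n with hG₂
  have hprof := fun (r : ℝ) (hr : 0 < r) (hr2 : r ^ 2 < 2) =>
    kernel_profile (s := s) (G := G) (G₁ := G₁) (G₂ := G₂) (fun z hz => hg.hasDerivAt hz)
      (fun z hz => (polyBounded_derivCoeff hg).hasDerivAt hz)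
      (fun z hz => by linear_combination hyp1_ode hg hz) hr hr2
  have hG0 : G 0 = 1 := by
    simp only [hG]
    rw [tsum_eq_single 0 (by intro n hn; simp [hn])]
    simp [hgdef, hyp1Coeff]
  have hk₂ : ContinuousOn (fun r : ℝ => r ^ s * (s * (s - 1) / r ^ 2 * G (1 - r ^ 2) -
      (4 * s + 2) * G₁ (1 - r ^ 2) + 4 * r ^ 2 * G₂ (1 - r ^ 2))) {r : ℝ | 0 < r ∧ r ^ 2 < 2} := by
    have hcomp : ∀ f : ℕ → ℝ, PolyBounded f → ContinuousOn
        (fun r : ℝ => ∑' n, f n * (1 - r ^ 2) ^ n) {r : ℝ | 0 < r ∧ r ^ 2 < 2} := fun f hf =>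
      hf.continuousOn.comp (f := fun r : ℝ => 1 - r ^ 2) (by fun_prop) fun r hr => by
        rw [mem_ofPred_eq, abs_lt]; constructor <;> nlinarith [hr.1, hr.2]
    have c0 := hcomp g hg
    have c1 := hcomp _ (polyBounded_derivCoeff hg)
    have c2 := hcomp _ (polyBounded_derivCoeff (polyBounded_derivCoeff hg))
    have cp : ContinuousOn (fun r : ℝ => r ^ s) {r : ℝ | 0 < r ∧ r ^ 2 < 2} :=
      continuousOn_id.rpow_const fun r hr => Or.inl hr.1.ne'
    have ci : ContinuousOn (fun r : ℝ => s * (s - 1) / r ^ 2) {r : ℝ | 0 < r ∧ r ^ 2 < 2} :=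
      continuousOn_const.div (by fun_prop) fun r hr => (pow_pos hr.1 2).ne'
    exact cp.mul (((ci.mul c0).sub (continuousOn_const.mul c1)).add
      ((by fun_prop : ContinuousOn (fun r : ℝ => 4 * r ^ 2) _).mul c2))
  have htrans := fun (x : ℝ) (hx : x ∈ Icc 0 θ) => transmutation
    (fun r hr hr2 => (hprof r hr hr2).1) (fun r hr hr2 => (hprof r hr hr2).2.1) hk₂
    (fun r hr hr2 => (hprof r hr hr2).2.2) (by simp [hG0]) c hx.1 (hx.2.trans_lt hθπ)
  set V : ℝ → ℝ := fun x => ∫ y in (0 : ℝ)..x,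
    (fun r : ℝ => r ^ s * G (1 - r ^ 2)) (Real.cos (x / 2) / Real.cos (y / 2)) * Real.cos (c * y)
    with hVdef
  set U : ℝ → ℝ := fun x => Real.cos (c * x) + ∫ y in (0 : ℝ)..x,
    -(1 / 2) * Real.sin (x / 2) / Real.cos (y / 2) *
    (fun r : ℝ => r ^ s * (s / r * G (1 - r ^ 2) - 2 * r * G₁ (1 - r ^ 2)))
      (Real.cos (x / 2) / Real.cos (y / 2)) * Real.cos (c * y) with hUdef
  have hgauge := fun (x : ℝ) (hx : x ∈ Icc 0 θ) =>
    hasDerivAt_gauge (V := V) (U := U) (c := c) (s := s) (hcos x hx) (htrans x hx).1 (htrans x hx).2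
  set μ : ℝ := (2 * k + 1) * (2 * k + 2 * β) with hμ
  have hμ0 : μ ≠ 0 := by
    refine mul_ne_zero (by positivity) ?_
    rcases Nat.eq_zero_or_pos k with rfl | hk
    · simpa using hβ0.ne
    · have : (1 : ℝ) ≤ k := by exact_mod_cast hk
      linarith
  have hP1 := jacobiP_one_pos (α := -(1 / 2)) (by norm_num) hβ k
  have hjac := fun (x : ℝ) (hx : x ∈ Icc 0 θ) =>
    hasDerivAt_jacobi_system hβ k hμ hμ0 (hcos x hx).ne'
  set Q := jacobiPoly (-(1 / 2)) β k with hQ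
  set P₁ := jacobiP (-(1 / 2)) β k 1 with hP₁
  have hRcos : ∀ x, jacobiR (-(1 / 2)) β k (Real.cos x) =
      Q.eval (-(Real.sin (x / 2) ^ 2)) / P₁ := by
    intro x
    have : (Real.cos x - 1) / 2 = -(Real.sin (x / 2) ^ 2) := by
      rw [Real.sin_sq_eq_half_sub]; ring_nf
    rw [jacobiR, jacobiP_eq_eval, this]
  have hQ0 : Q.eval 0 = P₁ := by rw [hP₁, jacobiP_eq_eval]; simp [hQ]
  have hinv : ContinuousOn (fun x => (Real.cos (x / 2))) (Icc 0 θ) := by fun_prop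
  have hne : ∀ x ∈ Icc 0 θ, Real.cos (x / 2) ≠ 0 := fun x hx => (hcos x hx).ne'
  have h4c : 4 * c ^ 2 - s ^ 2 = μ := by rw [hc, hs, hμ]; ring
  have hsβ : s + 1 / 2 = β := by rw [hs]; ring
  have huniq := linear_system_eq_zero (x₀ := 0) (x₁ := θ) hθ.le
    (f := fun x => Real.cos (x / 2) ^ (-s) * V x - 4 / μ *
      (β * (Real.sin (x / 2) * Q.eval (-(Real.sin (x / 2) ^ 2))) + Real.cos (x / 2) ^ 2 *
        (Real.sin (x / 2) * Q.derivative.eval (-(Real.sin (x / 2) ^ 2)))) / P₁)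
    (g := fun x => Real.cos (x / 2) ^ (-s - 1) *
      (U x + s / 2 * (Real.sin (x / 2) / Real.cos (x / 2)) * V x) -
        Q.eval (-(Real.sin (x / 2) ^ 2)) / P₁)
    (a := fun x => Real.cos (x / 2))
    (b := fun x => β * Real.sin (x / 2) / Real.cos (x / 2))
    (d := fun x => -(μ / (4 * Real.cos (x / 2))))
    hinv (ContinuousOn.div (by fun_prop) hinv hne)
    ((continuousOn_const.div (by fun_prop) fun x hx => mul_ne_zero four_ne_zero (hne x hx)).neg)
    (fun x hx => by
      convert! (hgauge x hx).1.sub ((hjac x hx).1.div_const P₁) using 1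
      ring)
    (fun x hx => by
      convert! (hgauge x hx).2.sub ((hjac x hx).2.div_const P₁) using 1
      rw [h4c, hsβ]
      ring)
    (by simp [hVdef]) (by simp [hUdef, hVdef, hQ0, div_self hP1.ne'])
  have hDθ := sub_eq_zero.1 huniq
  have hslice : ∀ {f : ℝ → ℝ}, ContinuousOn f {r : ℝ | 0 < r ∧ r ^ 2 < 2} →
      ContinuousOn (fun φ => f (Real.cos (θ / 2) / Real.cos (φ / 2))) (Icc 0 θ) := fun hf =>
    (continuousOn_comp_ratio hf).comp (f := fun φ => (θ, φ)) (by fun_prop)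
      fun φ hφ => mem_ratioDomain hθπ hφ.1 hφ.2
  have hi₀ : IntervalIntegrable (fun φ =>
      (fun r : ℝ => r ^ s * G (1 - r ^ 2)) (Real.cos (θ / 2) / Real.cos (φ / 2)) *
        Real.cos (c * φ)) volume 0 θ :=
    ContinuousOn.intervalIntegrable_of_Icc hθ.le ((hslice fun r hr =>
      (hprof r hr.1 hr.2).1.continuousAt.continuousWithinAt).mul (by fun_prop))
  have hi₁ : IntervalIntegrable (fun φ => -(1 / 2) * Real.sin (θ / 2) / Real.cos (φ / 2) *
      (fun r : ℝ => r ^ s * (s / r * G (1 - r ^ 2) - 2 * r * G₁ (1 - r ^ 2)))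
        (Real.cos (θ / 2) / Real.cos (φ / 2)) * Real.cos (c * φ)) volume 0 θ :=
    ContinuousOn.intervalIntegrable_of_Icc hθ.le (((continuousOn_const.div hinv hne).mul
      (hslice fun r hr => (hprof r hr.1 hr.2).2.1.continuousAt.continuousWithinAt)).mul
      (by fun_prop))
  rw [hRcos, ← hDθ]
  have hsplit : U θ + s / 2 * (Real.sin (θ / 2) / Real.cos (θ / 2)) * V θ =
      Real.cos (c * θ) + ∫ φ in (0 : ℝ)..θ, (-(1 / 2) * Real.sin (θ / 2) / Real.cos (φ / 2) *
        (fun r : ℝ => r ^ s * (s / r * G (1 - r ^ 2) - 2 * r * G₁ (1 - r ^ 2)))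
          (Real.cos (θ / 2) / Real.cos (φ / 2)) * Real.cos (c * φ) +
        s / 2 * (Real.sin (θ / 2) / Real.cos (θ / 2)) *
          ((fun r : ℝ => r ^ s * G (1 - r ^ 2)) (Real.cos (θ / 2) / Real.cos (φ / 2)) *
            Real.cos (c * φ))) := by
    rw [intervalIntegral.integral_add hi₁ (hi₀.const_mul _),
      intervalIntegral.integral_const_mul, ← add_assoc]
  have hG₁F : ∀ z, G₁ z = 1 / 4 * (β ^ 2 - 1 / 4) *
      gauss2F1 (β / 2 + 5 / 4) (β / 2 + 3 / 4) 2 z := by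
    intro z
    rw [gauss2F1, ← tsum_mul_left]
    refine tsum_congr fun n => ?_
    rw [hgdef, derivCoeff_hyp1Coeff]
    ring_nf
  rw [hsplit, mul_add, ← intervalIntegral.integral_const_mul,
    ← intervalIntegral.integral_const_mul]
  congr 1
  · congr 2
    rw [hs]; ring
  refine intervalIntegral.integral_congr fun φ hφ => ?_
  rw [uIcc_of_le hθ.le] at hφ
  have hC := hcos θ ⟨hθ.le, le_rfl⟩
  have hc' := hcos φ hφ
  have hz : (Real.cos φ - Real.cos θ) / (1 + Real.cos φ) =
      1 - (Real.cos (θ / 2) / Real.cos (φ / 2)) ^ 2 := by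
    have h1 : Real.cos φ = 2 * Real.cos (φ / 2) ^ 2 - 1 := by rw [← Real.cos_two_mul]; ring_nf
    have h2 : Real.cos θ = 2 * Real.cos (θ / 2) ^ 2 - 1 := by rw [← Real.cos_two_mul]; ring_nf
    rw [h1, h2]
    field_simp
    ring
  have he₁ : Real.cos (φ / 2) ^ (-β - 3 / 2) =
      (Real.cos (φ / 2) ^ s)⁻¹ / Real.cos (φ / 2) ^ 2 := by
    rw [← Real.rpow_neg hc'.le, ← Real.rpow_natCast, ← Real.rpow_sub hc', hs]
    congr 1; push_cast; ring
  have he₂ : Real.cos (θ / 2) ^ (-s - 1) = (Real.cos (θ / 2) ^ s)⁻¹ / Real.cos (θ / 2) := by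
    rw [Real.rpow_sub_one hC.ne', Real.rpow_neg hC.le]
  have hp₁ := (Real.rpow_pos_of_pos hc' s).ne'
  have hp₂ := (Real.rpow_pos_of_pos hC s).ne'
  simp only []
  rw [hz, he₁, he₂, Real.div_rpow hC.le hc'.le, hG₁F]
  field_simp
  ring
end
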